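/- Let k ≥ 3, let g = 2s ≥ 4 be even, set nc(k,g) = k(k−1)^s/2, and let ε be an integer with 0 < ε < k−1. Then there is no integer n for which a vgr(n, k, g, nc(k,g) − ε)-graph exists. -/

import Mathlib

open SimpleGraph

/-- The number of closed walks based at `u` of length `g` that are cycles.
Since each (unoriented, basepoint-free) cycle of length `g ≥ 3` through `u`
corresponds to exactly two such closed walks (one for each orientation), this
equals twice the number of cycles of length `g` containing `u`. -/
noncomputable def vertexCycleCount {V : Type*} (G : SimpleGraph V) (g : ℕ) (u : V) : ℕ :=
  Nat.card {p : G.Walk u u // p.IsCycle ∧ p.length = g}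

/-- `IsVGR G v k g lam` says that `G` is a vertex-girth-regular
`vgr(v,k,g,lam)`-graph: a finite simple `k`-regular graph of girth `g` on `v`
vertices in which every vertex lies on exactly `lam` cycles of length `g`
(encoded as: `2 * lam` closed cycle-walks based at each vertex). -/
def IsVGR {V : Type*} (G : SimpleGraph V) (v k g lam : ℕ) : Prop :=
  Finite V ∧ Nat.card V = v ∧ (∀ u : V, Nat.card (G.neighborSet u) = k) ∧
    G.girth = (g : ℕ∞) ∧ ∀ u : V, vertexCycleCount G g u = 2 * lam

namespace SimpleGraph

variable {V : Type*} {G : SimpleGraph V}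

/-- Below the girth, paths with prescribed endpoints are unique. -/
lemma Walk.IsPath.eq_of_length_add_lt_girth {u v : V} {p q : G.Walk u v} (hp : p.IsPath)
    (hq : q.IsPath) (h : p.length + q.length < G.girth) : p = q := by
  by_contra hne
  obtain ⟨w, hw, hwq, c, hc, hle⟩ := hp.exists_isCycle_length_le_add_of_ne hq hne
  have := girth_le_length hc
  omega

/-- Two distinct paths with the same endpoints, each of length half the girth, form a cycle. -/
lemma Walk.IsPath.isCycle_append_reverse_of_two_mul_eq_girth {u v : V} {p q : G.Walk u v} {s : ℕ}
    (hp : p.IsPath) (hq : q.IsPath) (hs : 2 ≤ s) (hg : G.girth = 2 * s) (hpl : p.length = s)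
    (hql : q.length = s) (hne : p ≠ q) : (p.append q.reverse).IsCycle := by
  classical
  refine hp.isCycle_append hq.reverse (fun x hxp hxq ↦ ?_) (by omega)
  have hxu : x ≠ u := by
    rintro rfl
    have := hp.support_nodup
    rw [← p.cons_tail_support] at this
    exact (List.nodup_cons.mp this).1 hxp
  have hxv : x ≠ v := by
    rintro rfl
    have := hq.reverse.support_nodup
    rw [← q.reverse.cons_tail_support] at this
    exact (List.nodup_cons.mp this).1 hxq
  have hp' : x ∈ p.support := List.mem_of_mem_tail hxp
  have hq' : x ∈ q.support := by simpa using List.mem_of_mem_tail hxq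
  apply hne
  have h1 := length_takeUntil_lt_length hp' hxv
  have h2 := length_takeUntil_lt_length hq' hxv
  have h3 := length_dropUntil_lt_length hp' hxu
  have h4 := length_dropUntil_lt_length hq' hxu
  rw [← p.take_spec hp', ← q.take_spec hq',
    (hp.takeUntil hp').eq_of_length_add_lt_girth (hq.takeUntil hq') (by omega),
    (hp.dropUntil hp').eq_of_length_add_lt_girth (hq.dropUntil hq') (by omega)]

/-- Distinct paths of half girth length between fixed endpoints have distinct penultimate
vertices. -/
lemma Walk.IsPath.eq_of_penultimate_eq {u v : V} {p q : G.Walk u v} (hp : p.IsPath)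
    (hq : q.IsPath) (hpn : ¬ p.Nil) (hqn : ¬ q.Nil) (h : p.length + q.length ≤ G.girth)
    (hpq : p.penultimate = q.penultimate) : p = q := by
  have h1 := length_dropLast_add_one hpn
  have h2 := length_dropLast_add_one hqn
  rw [← concat_dropLast (p.adj_penultimate hpn), ← concat_dropLast (q.adj_penultimate hqn)]
  have hp' := hp.dropLast
  have hq' := hq.dropLast
  revert h1 h2 hp' hq'
  generalize p.dropLast = p', q.dropLast = q', p.adj_penultimate hpn = ha,
    q.adj_penultimate hqn = hb
  revert p' q' ha hb
  rw [hpq]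
  intro p' q' ha hb h1 h2 hp' hq'
  rw [hp'.eq_of_length_add_lt_girth hq' (by omega)]

/-- The endpoint of a path of length less than `girth - 1` has no neighbour on the path but the
penultimate vertex. -/
lemma Walk.IsPath.mem_support_iff_eq_penultimate {u v w : V} {p : G.Walk u v} (hp : p.IsPath)
    (h : p.length + 1 < G.girth) (ha : G.Adj v w) :
    w ∈ p.support ↔ w = p.penultimate := by
  classical
  refine ⟨fun hw ↦ ?_, fun hw ↦ ?_⟩
  · have heq := (hp.dropUntil hw).eq_of_length_add_lt_girth (q := ha.symm.toWalk)
      (by simp [ha.ne']) (by have := p.length_dropUntil_le_length hw; simp; omega)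
    refine hp.eq_penultimate_of_mem_edges (p.edges_dropUntil_subset_edges hw ?_)
    rw [heq]
    simp [Sym2.eq_swap]
  · rw [hw]
    exact p.getVert_mem_support _

lemma Walk.append_injective_of_length_eq {u v w w' : V} {p : G.Walk u w} {q : G.Walk w v}
    {p' : G.Walk u w'} {q' : G.Walk w' v} (hl : p.length = p'.length)
    (h : p.append q = p'.append q') : ∃ hw : w = w', p.copy rfl hw = p' ∧ q.copy hw rfl = q' := by
  induction p with
  | nil =>
    cases p' with
    | nil => exact ⟨rfl, rfl, h⟩
    | cons => simp at hl
  | cons ha p ih =>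
    cases p' with
    | nil => simp at hl
    | cons hb p' =>
      simp only [cons_append, cons.injEq] at h
      obtain ⟨rfl, h⟩ := h
      obtain ⟨rfl, h1, h2⟩ := ih (by simpa using hl) (eq_of_heq h)
      exact ⟨rfl, by simpa using h1, h2⟩

variable (G) in
/-- Paths from `u` to `v` of length `n`. -/
abbrev PathOfLength (n : ℕ) (u v : V) : Type _ := {p : G.Walk u v // p.IsPath ∧ p.length = n}

instance [Finite V] (n : ℕ) (u v : V) : Finite (G.PathOfLength n u v) := by
  classical
  have := Fintype.ofFinite V
  have : Fintype (G.PathOfLength n u v) := inferInstance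
  infer_instance

/-- Concatenating a path with an edge to a new vertex. -/
def PathOfLength.concat {u : V} (n : ℕ)
    (x : Σ x : (Σ v, G.PathOfLength n u v), {w // G.Adj x.1 w ∧ w ∉ x.2.1.support}) :
    Σ v, G.PathOfLength (n + 1) u v :=
  ⟨x.2.1, x.1.2.1.concat x.2.2.1, x.1.2.2.1.concat x.2.2.2 x.2.2.1, by
    simp [x.1.2.2.2]⟩

lemma PathOfLength.concat_bijective (n : ℕ) (u : V) :
    Function.Bijective (concat (G := G) (u := u) n) := by
  constructor
  · rintro ⟨⟨v, p, hp⟩, w, hw⟩ ⟨⟨v', p', hp'⟩, w', hw'⟩ h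
    simp only [concat, Sigma.mk.injEq] at h
    obtain ⟨rfl, h⟩ := h
    have h := Subtype.ext_iff.mp (eq_of_heq h)
    obtain ⟨rfl, h2⟩ := Walk.concat_inj h
    simp only [Walk.copy_rfl_rfl] at h2
    subst h2
    rfl
  · rintro ⟨w, p, hp, hl⟩
    have hn : ¬ p.Nil := by rw [← Walk.length_eq_zero_iff]; omega
    have ha := p.adj_penultimate hn
    have he := Walk.concat_dropLast ha
    have hp' := hp
    rw [← he, Walk.concat_isPath_iff] at hp'
    refine ⟨⟨⟨p.penultimate, p.dropLast, hp'.1, by simp [hl]⟩, w, ha, hp'.2⟩, ?_⟩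
    simp [concat, he]

lemma card_pathOfLength_succ [Fintype V] {n k m : ℕ} {u : V}
    (h : ∀ v (p : G.PathOfLength n u v), Nat.card {w // G.Adj v w ∧ w ∉ p.1.support} = m)
    (hk : ∑ v, Nat.card (G.PathOfLength n u v) = k) :
    ∑ v, Nat.card (G.PathOfLength (n + 1) u v) = k * m := by
  classical
  have := Fintype.ofFinite (Σ v, G.PathOfLength n u v)
  rw [← Nat.card_sigma, ← Nat.card_eq_of_bijective _ (PathOfLength.concat_bijective n u),
    Nat.card_sigma, Finset.sum_congr rfl (fun x _ ↦ h x.1 x.2), ← hk, ← Nat.card_sigma]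
  simp

lemma card_adj_notMem_support [Finite V] {u v : V} {p : G.Walk u v} (hp : p.IsPath)
    (h : p.length + 1 < G.girth) (hn : ¬ p.Nil) :
    Nat.card {w // G.Adj v w ∧ w ∉ p.support} = Nat.card (G.neighborSet v) - 1 := by
  have hs : {w | G.Adj v w ∧ w ∉ p.support} = G.neighborSet v \ {p.penultimate} := by
    ext w
    simp only [Set.mem_ofPred_eq, Set.mem_sdiff, mem_neighborSet, Set.mem_singleton_iff]
    exact and_congr_right fun ha ↦ not_congr (hp.mem_support_iff_eq_penultimate h ha)
  have := Set.ncard_sdiff_singleton_of_mem (s := G.neighborSet v) (a := p.penultimate)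
    (p.adj_penultimate hn).symm
  rw [← hs] at this
  exact this

/-- The number of paths of length `n + 1` from a vertex, in the locally tree-like range. -/
lemma sum_card_pathOfLength [Fintype V] {k : ℕ} (hk : ∀ u : V, Nat.card (G.neighborSet u) = k)
    (u : V) (n : ℕ) (hn : n + 1 < G.girth) :
    ∑ v, Nat.card (G.PathOfLength (n + 1) u v) = k * (k - 1) ^ n := by
  classical
  induction n with
  | zero =>
    rw [card_pathOfLength_succ (k := 1) (m := k)]
    · simp
    · rintro v ⟨p, hp, hl⟩
      cases p with
      | nil =>
        rw [← hk u]
        refine Nat.card_congr (Equiv.subtypeEquivRight fun w ↦ ?_)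
        simpa using fun h : G.Adj u w ↦ h.ne'
      | cons => simp at hl
    · rw [← Nat.card_sigma, Nat.card_eq_one_iff_unique]
      refine ⟨⟨?_⟩, ⟨u, .nil, by simp⟩⟩
      rintro ⟨v, p, hp, hl⟩ ⟨w, q, hq, hl'⟩
      cases p with
      | nil =>
        cases q with
        | nil => rfl
        | cons => simp at hl'
      | cons => simp at hl
  | succ n ih =>
    rw [card_pathOfLength_succ (m := k - 1) _ (ih (by omega)), pow_succ, mul_assoc]
    rintro v ⟨p, hp, hl⟩
    rw [card_adj_notMem_support hp (by omega) (by rw [← Walk.length_eq_zero_iff]; omega), hk]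

/-- The number of paths of half girth length between two vertices is at most the degree. -/
lemma card_pathOfLength_le [Finite V] {s : ℕ} (hs : 0 < s) (hg : G.girth = 2 * s) (u v : V) :
    Nat.card (G.PathOfLength s u v) ≤ Nat.card (G.neighborSet v) := by
  have hn (p : G.PathOfLength s u v) : ¬ p.1.Nil := by
    rw [← Walk.length_eq_zero_iff, p.2.2]
    omega
  refine Nat.card_le_card_of_injective
    (fun p ↦ ⟨p.1.penultimate, (p.1.adj_penultimate (hn p)).symm⟩) fun p q h ↦ ?_
  refine Subtype.ext (p.2.1.eq_of_penultimate_eq q.2.1 (hn p) (hn q) ?_ (Subtype.ext_iff.mp h))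
  rw [p.2.2, q.2.2, hg, two_mul]

/-- Girth cycles through `u` correspond to pairs of distinct half girth length paths. -/
lemma vertexCycleCount_eq_sum [Fintype V] {s : ℕ} (hs : 2 ≤ s) (hg : G.girth = 2 * s) (u : V) :
    vertexCycleCount G (2 * s) u =
      ∑ v, Nat.card (G.PathOfLength s u v) * (Nat.card (G.PathOfLength s u v) - 1) := by
  classical
  let f : (Σ v, {x : G.PathOfLength s u v × G.PathOfLength s u v // x.1 ≠ x.2}) →
      {p : G.Walk u u // p.IsCycle ∧ p.length = 2 * s} := fun x ↦
    ⟨x.2.1.1.1.append x.2.1.2.1.reverse,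
      x.2.1.1.2.1.isCycle_append_reverse_of_two_mul_eq_girth x.2.1.2.2.1 hs hg x.2.1.1.2.2
        x.2.1.2.2.2 (Subtype.coe_ne_coe.mpr x.2.2),
      by simp [x.2.1.1.2.2, x.2.1.2.2.2, two_mul]⟩
  have hf : Function.Bijective f := by
    constructor
    · rintro ⟨v, ⟨⟨p, hp, hpl⟩, ⟨q, hq, hql⟩⟩, hne⟩ ⟨v', ⟨⟨p', hp', hpl'⟩, ⟨q', hq', hql'⟩⟩, hne'⟩ h
      have h := Subtype.ext_iff.mp h
      obtain ⟨rfl, h1, h2⟩ := Walk.append_injective_of_length_eq (hpl.trans hpl'.symm) h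
      simp only [Walk.copy_rfl_rfl] at h1 h2
      obtain rfl := h1
      obtain rfl := Walk.reverse_injective h2
      rfl
    · rintro ⟨c, hc, hl⟩
      have hd : (c.drop s).length = s := by simp [hl]; omega
      have ht : (c.take s).length = s := by simp [Walk.take_length, hl]; omega
      have happ := c.append_take_drop_eq s
      refine ⟨⟨c.getVert s, ⟨⟨c.take s, hc.isPath_take (by omega), ht⟩,
        ⟨(c.drop s).reverse, (hc.isPath_drop (by omega)).reverse, by simpa using hd⟩⟩, ?_⟩, ?_⟩
      · intro h
        have h := Subtype.ext_iff.mp h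
        simp only at h
        have htr := hc.isCircuit.isTrail
        rw [← happ, Walk.isTrail_append] at htr
        have hdj := htr.2.2
        rw [h, Walk.edges_reverse] at hdj
        have hne : (c.drop s).edges ≠ [] := by
          rw [← List.length_pos_iff_ne_nil, Walk.length_edges, hd]
          omega
        obtain ⟨e, he⟩ := List.exists_mem_of_ne_nil _ hne
        exact hdj (List.mem_reverse.mpr he) he
      · simp [f, happ]
  rw [vertexCycleCount, ← Nat.card_eq_of_bijective f hf, Nat.card_sigma]
  refine Finset.sum_congr rfl fun v _ ↦ ?_
  have := Fintype.ofFinite (G.PathOfLength s u v)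
  rw [Nat.card_eq_fintype_card, Nat.card_eq_fintype_card, Fintype.card_subtype]
  have := Finset.offDiag_card (Finset.univ : Finset (G.PathOfLength s u v))
  rw [Finset.card_univ] at this
  rw [Nat.mul_sub_one, ← this]
  congr 1
  ext x
  simp

end SimpleGraph

/-- If integers between `0` and `k` sum to a multiple of `k`, then either all of them are `0` or
`k`, or at least two of them are neither. -/
lemma sum_mul_sub_eq_zero_or_le {ι : Type*} [Fintype ι] {f : ι → ℕ} {k : ℕ}
    (hf : ∀ i, f i ≤ k) (hdvd : k ∣ ∑ i, f i) :
    ∑ i, f i * (k - f i) = 0 ∨ 2 * (k - 1) ≤ ∑ i, f i * (k - f i) := by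
  classical
  by_cases h : ∀ i, f i * (k - f i) = 0
  · exact .inl (Finset.sum_eq_zero fun i _ ↦ h i)
  right
  have hle (i) (hi : f i * (k - f i) ≠ 0) : k - 1 ≤ f i * (k - f i) := by
    rw [mul_ne_zero_iff] at hi
    obtain ⟨a, ha⟩ := Nat.exists_eq_add_of_le' (Nat.one_le_iff_ne_zero.mpr hi.1)
    obtain ⟨b, hb⟩ := Nat.exists_eq_add_of_le' (Nat.one_le_iff_ne_zero.mpr hi.2)
    have := hf i
    rw [hb, ha]
    have : k - 1 = a + b + 1 := by omega
    rw [this]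
    nlinarith [Nat.zero_le (a * b)]
  push Not at h
  obtain ⟨i, hi⟩ := h
  have hj : ∃ j ≠ i, f j * (k - f j) ≠ 0 := by
    by_contra! hj
    have hdi : k ∣ ∑ j ∈ Finset.univ.erase i, f j := Finset.dvd_sum fun j hjm ↦ by
      have h0 := hj j (Finset.ne_of_mem_erase hjm)
      have := hf j
      rcases Nat.mul_eq_zero.mp h0 with h0 | h0
      · simp [h0]
      · rw [show f j = k by omega]
    rw [← Finset.add_sum_erase _ _ (Finset.mem_univ i)] at hdvd
    have hki : k ∣ f i := (Nat.dvd_add_left hdi).mp hdvd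
    rw [mul_ne_zero_iff] at hi
    have := Nat.le_of_dvd (Nat.pos_of_ne_zero hi.1) hki
    omega
  obtain ⟨j, hji, hj⟩ := hj
  calc 2 * (k - 1) ≤ f i * (k - f i) + f j * (k - f j) := by
        have := hle i hi
        have := hle j hj
        omega
    _ = ∑ l ∈ {i, j}, f l * (k - f l) := by
      rw [Finset.sum_pair hji.symm]
    _ ≤ _ := Finset.sum_le_sum_of_subset (Finset.subset_univ _)

/-- for `k ≥ 3`, even `g = 2s ≥ 4`, and `0 < ε < k-1`, there is
no `vgr(n, k, g, k(k-1)^s/2 - ε)`-graph. -/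
theorem no_vgr_even_girth_near_moore (k g s eps : ℕ) (hk : 3 ≤ k)
    (hgs : g = 2 * s) (hg : 4 ≤ g) (he1 : 0 < eps) (he2 : eps < k - 1) :
    ¬ ∃ (n : ℕ) (V : Type) (G : SimpleGraph V),
      IsVGR G n k g (k * (k - 1) ^ s / 2 - eps) := by
  rintro ⟨n, V, G, hfin, -, hreg, hgirth, hcount⟩
  have hgirth : G.girth = 2 * s := by
    rw [← hgs]
    exact_mod_cast hgirth
  have := Fintype.ofFinite V
  have hcyc : ¬ G.IsAcyclic := by
    rw [← girth_eq_zero]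
    omega
  obtain ⟨u, -⟩ := exists_girth_eq_length.mpr hcyc
  obtain ⟨t, rfl⟩ : ∃ t, s = t + 1 := ⟨s - 1, by omega⟩
  have hsum := sum_card_pathOfLength hreg u t (by omega)
  have hcyc := hcount u
  rw [hgs, vertexCycleCount_eq_sum (by omega) hgirth] at hcyc
  have hle (v : V) : Nat.card (G.PathOfLength (t + 1) u v) ≤ k :=
    (card_pathOfLength_le (by omega) hgirth u v).trans (hreg v).le
  have hdich := sum_mul_sub_eq_zero_or_le hle (hsum ▸ dvd_mul_right _ _)
  have htot : ∑ v, Nat.card (G.PathOfLength (t + 1) u v) *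
        (Nat.card (G.PathOfLength (t + 1) u v) - 1) +
      ∑ v, Nat.card (G.PathOfLength (t + 1) u v) * (k - Nat.card (G.PathOfLength (t + 1) u v)) =
      k * (k - 1) ^ (t + 1) := by
    rw [pow_succ, ← mul_assoc, ← hsum, ← Finset.sum_add_distrib, Finset.sum_mul]
    refine Finset.sum_congr rfl fun v _ ↦ ?_
    have := hle v
    rcases Nat.eq_zero_or_pos (Nat.card (G.PathOfLength (t + 1) u v)) with h | h
    · simp [h]
    · rw [← mul_add]
      congr 1
      omega
  have heven : 2 ∣ k * (k - 1) ^ (t + 1) := by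
    rw [pow_succ', ← mul_assoc]
    exact (Nat.even_mul_pred_self k).two_dvd.mul_right _
  have hbig : k * (k - 1) ≤ k * (k - 1) ^ (t + 1) :=
    Nat.mul_le_mul_left k (Nat.le_self_pow (by omega) _)
  have : 2 * (k - 1) ≤ k * (k - 1) := Nat.mul_le_mul_right _ (by omega)
  omega
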